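/- Let G be a nontrivial additive group and let X_G be the set of pairs (a, f) with a > 0 real and f : ℝ → G such that f(t) = 0 for t ≤ a, f(t) = 0 for all sufficiently large t, and f is piecewise constant from the left on (a, ∞). Define (a, f) ⪯ (b, g) iff a ≤ b and f(t) = g(t) for all t > b. Then ⪯ is a partial order on X_G, every two elements have a least upper bound (namely, for p = (a,f) and q = (b,g), the element (c, h) where c = max(a, b, inf{x : f = g on (x, ∞)}) and h(t) = f(t) for t > c, h(t) = 0 for t ≤ c), and ⪯ is upper semilinear: for every p ∈ X_G the upper cone {q : p ⪯ q} is linearly ordered by ⪯. -/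

import Mathlib

/-- A point of the tree `X_G`: a pair `(a, f)` with `a > 0`, `f : ℝ → G` vanishing on
`(-∞, a]`, eventually zero, and piecewise constant from the left on `(a, ∞)`. -/
structure TreePt (G : Type*) [AddGroup G] where
  a : ℝ
  f : ℝ → G
  a_pos : 0 < a
  f_zero : ∀ t : ℝ, t ≤ a → f t = 0
  f_ev : ∃ b : ℝ, ∀ t : ℝ, b ≤ t → f t = 0
  f_pcl : ∀ x : ℝ, a < x → ∃ ε > 0, ∀ s ∈ Set.Icc (x - ε) x ∩ Set.Ioi a, f s = f x

/-- `c(p,q) = max(a, b, inf {x | f = g on (x, ∞)})`. -/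
noncomputable def cval {G : Type*} [AddGroup G] (p q : TreePt G) : ℝ :=
  max (max p.a q.a) (sInf {x : ℝ | ∀ t : ℝ, x < t → p.f t = q.f t})

/-- The metric `ρ(p,q) = (c(p,q) - a) + (c(p,q) - b)` on `X_G`. -/
noncomputable def rho {G : Type*} [AddGroup G] (p q : TreePt G) : ℝ :=
  (cval p q - p.a) + (cval p q - q.a)

/-- The partial order: `(a,f) ⪯ (b,g)` iff `a ≤ b` and `f = g` on `(b, ∞)`. -/
def tle {G : Type*} [AddGroup G] (p q : TreePt G) : Prop :=
  p.a ≤ q.a ∧ ∀ t : ℝ, q.a < t → p.f t = q.f t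

theorem tle_refl {G : Type*} [AddGroup G] (p : TreePt G) : tle p p :=
  ⟨le_rfl, fun _ _ => rfl⟩

theorem tle_trans {G : Type*} [AddGroup G] {p q r : TreePt G} (hpq : tle p q)
    (hqr : tle q r) : tle p r :=
  ⟨hpq.1.trans hqr.1, fun t ht => (hpq.2 t (hqr.1.trans_lt ht)).trans (hqr.2 t ht)⟩

theorem tle_antisymm {G : Type*} [AddGroup G] {p q : TreePt G} (hpq : tle p q)
    (hqp : tle q p) : p = q := by
  have ha : p.a = q.a := le_antisymm hpq.1 hqp.1
  have hf : p.f = q.f := by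
    funext t
    rcases le_or_gt t q.a with ht | ht
    · rw [q.f_zero t ht, p.f_zero t (ht.trans_eq ha.symm)]
    · exact hpq.2 t ht
  cases p
  cases q
  cases ha
  cases hf
  rfl

theorem tle_or_tle_of_tle {G : Type*} [AddGroup G] {p q r : TreePt G} (hpq : tle p q)
    (hpr : tle p r) : tle q r ∨ tle r q := by
  rcases le_total q.a r.a with h | h
  · exact Or.inl ⟨h, fun t ht => (hpq.2 t (h.trans_lt ht)).symm.trans (hpr.2 t ht)⟩
  · exact Or.inr ⟨h, fun t ht => (hpr.2 t (h.trans_lt ht)).symm.trans (hpq.2 t ht)⟩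

theorem TreePt.f_eq_of_cval_lt {G : Type*} [AddGroup G] {p q : TreePt G} {t : ℝ}
    (ht : cval p q < t) : p.f t = q.f t := by
  obtain ⟨b, hb⟩ := p.f_ev
  obtain ⟨b', hb'⟩ := q.f_ev
  have hne : {x : ℝ | ∀ t : ℝ, x < t → p.f t = q.f t}.Nonempty :=
    ⟨max b b', fun u hu => by
      rw [hb u ((le_max_left _ _).trans hu.le), hb' u ((le_max_right _ _).trans hu.le)]⟩
  obtain ⟨x, hx, hxt⟩ := exists_lt_of_csInf_lt hne ((le_max_right _ _).trans_lt ht)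
  exact hx t hxt

theorem cval_le_of_tle {G : Type*} [AddGroup G] {p q r : TreePt G} (hp : tle p r)
    (hq : tle q r) : cval p q ≤ r.a := by
  refine max_le (max_le hp.1 hq.1) ?_
  by_cases hbdd : BddBelow {x : ℝ | ∀ t : ℝ, x < t → p.f t = q.f t}
  · exact csInf_le hbdd fun t ht => (hp.2 t ht).trans (hq.2 t ht).symm
  · rw [Real.sInf_of_not_bddBelow hbdd]
    exact r.a_pos.le

open Classical in
/-- The truncation of a point `p` at a level `c ≥ p.a`: its function is kept on `(c, ∞)` and
set to zero on `(-∞, c]`. -/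
noncomputable def TreePt.truncate {G : Type*} [AddGroup G] (p : TreePt G) (c : ℝ)
    (hc : p.a ≤ c) : TreePt G where
  a := c
  f t := if c < t then p.f t else 0
  a_pos := p.a_pos.trans_le hc
  f_zero _ ht := if_neg ht.not_gt
  f_ev := by
    obtain ⟨b, hb⟩ := p.f_ev
    exact ⟨b, fun t ht => by simp [hb t ht]⟩
  f_pcl x hx := by
    obtain ⟨ε, hε, h⟩ := p.f_pcl x (hc.trans_lt hx)
    refine ⟨ε, hε, fun s hs => ?_⟩
    rw [if_pos (Set.mem_Ioi.mp hs.2), if_pos hx]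
    exact h s ⟨hs.1, hc.trans_lt (Set.mem_Ioi.mp hs.2)⟩

theorem TreePt.truncate_f_of_lt {G : Type*} [AddGroup G] (p : TreePt G) {c : ℝ}
    (hc : p.a ≤ c) {t : ℝ} (ht : c < t) : (p.truncate c hc).f t = p.f t :=
  if_pos ht

/-- `⪯` is a partial order on `X_G`, any two elements have a least upper bound of
the explicitly described form, and `⪯` is upper semilinear. -/
theorem stmt11 {G : Type*} [AddGroup G] [Nontrivial G] :
    (∀ p : TreePt G, tle p p) ∧
    (∀ p q : TreePt G, tle p q → tle q p → p = q) ∧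
    (∀ p q r : TreePt G, tle p q → tle q r → tle p r) ∧
    (∀ p q : TreePt G, ∃ s : TreePt G, s.a = cval p q ∧
      (∀ t : ℝ, cval p q < t → s.f t = p.f t) ∧ (∀ t : ℝ, t ≤ cval p q → s.f t = 0) ∧
      tle p s ∧ tle q s ∧ ∀ r : TreePt G, tle p r → tle q r → tle s r) ∧
    (∀ p q r : TreePt G, tle p q → tle p r → tle q r ∨ tle r q) := by
  refine ⟨tle_refl, fun _ _ => tle_antisymm, fun _ _ _ => tle_trans, fun p q => ?_,
    fun _ _ _ => tle_or_tle_of_tle⟩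
  have hpc : p.a ≤ cval p q := (le_max_left _ _).trans (le_max_left _ _)
  have hqc : q.a ≤ cval p q := (le_max_right _ _).trans (le_max_left _ _)
  refine ⟨p.truncate (cval p q) hpc, rfl, fun t ht => p.truncate_f_of_lt hpc ht,
    (p.truncate (cval p q) hpc).f_zero, ⟨hpc, fun t ht => (p.truncate_f_of_lt hpc ht).symm⟩,
    ⟨hqc, fun t ht => ?_⟩, fun r hpr hqr => ?_⟩
  · exact (TreePt.f_eq_of_cval_lt ht).symm.trans (p.truncate_f_of_lt hpc ht).symm
  · have hcr := cval_le_of_tle hpr hqr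
    exact ⟨hcr, fun t ht => (p.truncate_f_of_lt hpc (hcr.trans_lt ht)).trans (hpr.2 t ht)⟩
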